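/- Fix k ≥ 1 and k-periodic real sequences (a_n), (b_n), (c_n), (d_n) with c_n ≠ 0 and a_n d_n − b_n c_n ≠ 0 for all n. Assume T ≠ 0, Δ = T² − 4D = 0, and c̃_i ≠ 0 for all 0 ≤ i ≤ k−1. Then every solution (x_n)_{n≥0} of the Riccati recurrence satisfies lim_{n→∞} x_{nk+i} = (ã_i − d̃_i)/(2 c̃_i) for each 0 ≤ i ≤ k−1. -/

import Mathlib

/-- The matrix `!![a n, b n; c n, d n]` of coefficients. -/
def matA (a b c d : ℕ → ℝ) (n : ℕ) : Matrix (Fin 2) (Fin 2) ℝ := !![a n, b n; c n, d n]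

/-- `seg A i n = A (i+n-1) * ⋯ * A (i+1) * A i`, with `seg A i 0 = 1`. -/
def seg (A : ℕ → Matrix (Fin 2) (Fin 2) ℝ) (i : ℕ) : ℕ → Matrix (Fin 2) (Fin 2) ℝ
  | 0 => 1
  | n + 1 => A (i + n) * seg A i n

/-- `B_i = A_{i-1} ⋯ A_0 ⋅ A_{k-1} ⋯ A_i`. -/
def matB (a b c d : ℕ → ℝ) (k i : ℕ) : Matrix (Fin 2) (Fin 2) ℝ :=
  seg (matA a b c d) 0 i * seg (matA a b c d) i (k - i)

/-- `(x_n)` is a solution of the Riccati recurrence `x_{n+1} = (a_n x_n + b_n)/(c_n x_n + d_n)`. -/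
def IsRiccatiSol (a b c d : ℕ → ℝ) (x : ℕ → ℝ) : Prop :=
  ∀ n, c n * x n + d n ≠ 0 ∧ x (n + 1) = (a n * x n + b n) / (c n * x n + d n)

theorem aux_seg_add (A : ℕ → Matrix (Fin 2) (Fin 2) ℝ) (i m n : ℕ) :
    seg A i (m + n) = seg A (i + m) n * seg A i m := by
  induction n with
  | zero => simp [seg]
  | succ n ih =>
    rw [← Nat.add_assoc]
    simp only [seg]
    rw [ih, Matrix.mul_assoc, Nat.add_assoc]

theorem aux_seg_per (A : ℕ → Matrix (Fin 2) (Fin 2) ℝ) (k : ℕ) (h : ∀ n, A (n + k) = A n)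
    (i m : ℕ) : seg A (i + k) m = seg A i m := by
  induction m with
  | zero => simp [seg]
  | succ n ih =>
    simp only [seg]
    rw [ih, ← h (i + n)]
    congr 2
    omega

theorem aux_seg_per_mul (A : ℕ → Matrix (Fin 2) (Fin 2) ℝ) (k : ℕ) (h : ∀ n, A (n + k) = A n)
    (i m n : ℕ) : seg A (n * k + i) m = seg A i m := by
  induction n with
  | zero => simp
  | succ n ih =>
    rw [← ih, ← aux_seg_per A k h (n * k + i)]
    congr 1
    ring

theorem aux_step (a b c d x : ℕ → ℝ) (h : IsRiccatiSol a b c d x) (i m : ℕ) :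
    ∃ w : ℝ, w ≠ 0 ∧
      seg (matA a b c d) i m 0 0 * x i + seg (matA a b c d) i m 0 1 = w * x (i + m) ∧
      seg (matA a b c d) i m 1 0 * x i + seg (matA a b c d) i m 1 1 = w := by
  induction m with
  | zero => exact ⟨1, by simp [seg]⟩
  | succ m ih =>
    obtain ⟨w, hw, h0, h1⟩ := ih
    obtain ⟨g, hx⟩ := h (i + m)
    refine ⟨w * (c (i + m) * x (i + m) + d (i + m)), mul_ne_zero hw g, ?_, ?_⟩
    · rw [← Nat.add_assoc, hx, mul_assoc, mul_div_cancel₀ _ g]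
      simp only [seg, matA, Matrix.mul_apply, Fin.sum_univ_two, Matrix.of_apply,
        Matrix.cons_val', Matrix.cons_val_zero, Matrix.cons_val_one, Matrix.cons_val_fin_one] at *
      linear_combination a (i + m) * h0 + b (i + m) * h1
    · simp only [seg, matA, Matrix.mul_apply, Fin.sum_univ_two, Matrix.of_apply,
        Matrix.cons_val', Matrix.cons_val_zero, Matrix.cons_val_one, Matrix.cons_val_fin_one] at *
      linear_combination c (i + m) * h0 + d (i + m) * h1

open Filter in
theorem aux_lim (p q r s : ℝ) (hr : r ≠ 0) (hT : p + s ≠ 0)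
    (hD : (p + s) ^ 2 - 4 * (p * s - q * r) = 0) (y : ℕ → ℝ)
    (hy : ∀ n, (r * y n + s) * y (n + 1) = p * y n + q) (hne : ∀ n, r * y n + s ≠ 0) :
    Tendsto y atTop (nhds ((p - s) / (2 * r))) := by
  obtain ⟨L, hL⟩ : ∃ L, L = (p - s) / (2 * r) := ⟨_, rfl⟩
  obtain ⟨l, hl⟩ : ∃ l, l = (p + s) / 2 := ⟨_, rfl⟩
  rw [← hL]
  have hl0 : l ≠ 0 := by rw [hl]; exact div_ne_zero hT two_ne_zero
  have hLr : 2 * r * L = p - s := by rw [hL]; field_simp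
  have hp : p = l + r * L := by linarith
  have hs : s = l - r * L := by linarith
  have hq : q = - r * L ^ 2 := by
    apply mul_left_cancel₀ hr
    subst hp hs
    linarith
  have hu : ∀ n, (r * (y n - L) + l) * (y (n + 1) - L) = l * (y n - L) := by
    intro n
    have := hy n
    rw [hp, hs, hq] at this
    linear_combination this
  have hn : ∀ n, r * (y n - L) + l ≠ 0 := by
    intro n h
    apply hne n
    rw [hs]; linarith
  have key : ∀ n : ℕ, (y n - L) * (l + n * (r * (y 0 - L))) = l * (y 0 - L) := by
    intro n
    induction n with
    | zero => simp; ring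
    | succ n ih =>
      by_cases h0 : y 0 - L = 0
      · rw [h0] at ih ⊢
        have : y n - L = 0 := by simpa [hl0] using ih
        have h2 := hu n
        rw [this] at h2
        have : y (n + 1) - L = 0 := by simpa [hl0] using h2
        rw [this]; simp
      · have hyn : y n - L ≠ 0 := by
          intro h
          rw [h, zero_mul] at ih
          exact mul_ne_zero hl0 h0 ih.symm
        apply mul_left_cancel₀ hyn
        push_cast
        linear_combination (y (n + 1) - L) * ih + (y 0 - L) * hu n
  by_cases h0 : y 0 - L = 0
  · have : y = fun _ => L := by
      funext n
      have := key n
      rw [h0] at this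
      have : y n - L = 0 := by simpa [hl0] using this
      linarith
    rw [this]; exact tendsto_const_nhds
  · have hden : ∀ n : ℕ, l + n * (r * (y 0 - L)) ≠ 0 := by
      intro n h
      have := key n
      rw [h, mul_zero] at this
      exact mul_ne_zero hl0 h0 this.symm
    have hg : r * (y 0 - L) ≠ 0 := mul_ne_zero hr h0
    have e : y = fun n : ℕ => L + (l * (y 0 - L)) / (l + n * (r * (y 0 - L))) := by
      funext n
      rw [← key n, mul_div_cancel_right₀ _ (hden n)]; ring
    have hcob : Tendsto (fun n : ℕ => l + n * (r * (y 0 - L))) atTop (Bornology.cobounded ℝ) := by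
      rw [← tendsto_norm_atTop_iff_cobounded]
      have h1 : Tendsto (fun n : ℕ => (n : ℝ) * |r * (y 0 - L)| - |l|) atTop atTop :=
        tendsto_atTop_add_const_right _ _
          (tendsto_natCast_atTop_atTop.atTop_mul_const (abs_pos.mpr hg))
      refine tendsto_atTop_mono (fun n => ?_) h1
      have := abs_sub_abs_le_abs_sub ((n : ℝ) * (r * (y 0 - L))) (-l)
      rw [abs_mul, Nat.abs_cast, abs_neg, sub_neg_eq_add, add_comm _ l] at this
      exact this
    rw [e]
    have := (tendsto_inv₀_cobounded.comp hcob).const_mul (l * (y 0 - L))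
    have := this.const_add L
    simpa [div_eq_mul_inv, Function.comp_def] using this

open Filter in
/-- `T ≠ 0`, `Δ = 0` case: `x_{nk+i} → (ã_i - d̃_i)/(2c̃_i)`. -/
theorem stmt8 (k : ℕ) (hk : 1 ≤ k) (a b c d : ℕ → ℝ)
    (hper : ∀ n, a (n + k) = a n ∧ b (n + k) = b n ∧ c (n + k) = c n ∧ d (n + k) = d n)
    (hc : ∀ n, c n ≠ 0) (hdet : ∀ n, a n * d n - b n * c n ≠ 0)
    (hT : (matB a b c d k 0).trace ≠ 0)
    (hΔ : (matB a b c d k 0).trace ^ 2 - 4 * (matB a b c d k 0).det = 0)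
    (hctil : ∀ i < k, (matB a b c d k i) 1 0 ≠ 0) :
    ∀ xs : ℕ → ℝ, IsRiccatiSol a b c d xs → ∀ i < k,
      Tendsto (fun n => xs (n * k + i)) atTop
        (nhds (((matB a b c d k i) 0 0 - (matB a b c d k i) 1 1) /
          (2 * (matB a b c d k i) 1 0))) := by
  intro xs hxs i hi
  have hA : ∀ n, matA a b c d (n + k) = matA a b c d n := by
    intro n
    obtain ⟨h1, h2, h3, h4⟩ := hper n
    simp only [matA, h1, h2, h3, h4]
  have hB : matB a b c d k i = seg (matA a b c d) i k := by
    have h := aux_seg_add (matA a b c d) i (k - i) i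
    rw [show k - i + i = k by omega, show i + (k - i) = 0 + k by omega,
      aux_seg_per _ k hA] at h
    rw [h, matB]
  have hB0 : matB a b c d k 0 = seg (matA a b c d) i (k - i) * seg (matA a b c d) 0 i := by
    have h := aux_seg_add (matA a b c d) 0 i (k - i)
    rw [show i + (k - i) = k by omega, Nat.zero_add] at h
    rw [← h]; simp [matB, seg]
  have htr : (matB a b c d k 0).trace = (matB a b c d k i).trace := by
    rw [hB0, Matrix.trace_mul_comm, matB]
  have hde : (matB a b c d k 0).det = (matB a b c d k i).det := by
    rw [hB0, Matrix.det_mul_comm, matB]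
  rw [htr, Matrix.trace_fin_two] at hT
  rw [htr, hde, Matrix.trace_fin_two, Matrix.det_fin_two] at hΔ
  have hst : ∀ n, ∃ w : ℝ, w ≠ 0 ∧
      matB a b c d k i 0 0 * xs (n * k + i) + matB a b c d k i 0 1 = w * xs ((n + 1) * k + i) ∧
      matB a b c d k i 1 0 * xs (n * k + i) + matB a b c d k i 1 1 = w := by
    intro n
    have h := aux_step a b c d xs hxs (n * k + i) k
    rw [aux_seg_per_mul _ k hA, ← hB, show n * k + i + k = (n + 1) * k + i by ring] at h
    exact h
  refine aux_lim _ _ _ _ (hctil i hi) hT hΔ (fun n => xs (n * k + i)) ?_ ?_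
  · intro n
    obtain ⟨w, _, h0, h1⟩ := hst n
    show _ * xs ((n + 1) * k + i) = _
    rw [h1, h0]
  · intro n
    obtain ⟨w, hw, h0, h1⟩ := hst n
    show _ * xs (n * k + i) + _ ≠ 0
    rw [h1]; exact hw
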